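/- Let G be a finite simple graph, let P be a probability distribution on V(G) with H(G,P) = log₂ χ_f(G), and let w be an optimal fractional coloring of G, i.e., a nonnegative weight function on the independent sets of G with Σ_{I∋v} w_I ≥ 1 for every vertex v and Σ_I w_I = χ_f(G). Let x* = Σ_I (w_I/χ_f(G))·1_I ∈ VP(G), where 1_I is the characteristic vector of I. Then x*_v = 1/χ_f(G) for every vertex v with p_v > 0, and every independent set I with w_I > 0 satisfies Σ_{v∈I} p_v = α_P, where α_P is the maximum of Σ_{v∈J} p_v over all independent sets J of G. -/

import Mathlib

open Finset

/-- `I` is an independent set of the graph `G`. -/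
def IsIndepSet {V : Type*} (G : SimpleGraph V) (I : Finset V) : Prop :=
  ∀ u ∈ I, ∀ w ∈ I, ¬ G.Adj u w

/-- The characteristic vector (in `ℝ^V`) of a finite set of vertices. -/
def charVec {V : Type*} [DecidableEq V] (I : Finset V) : V → ℝ :=
  fun v => if v ∈ I then 1 else 0

/-- The vertex packing polytope `VP(G)`: the convex hull of the characteristic
vectors of the independent sets of `G`. -/
def vertexPacking {V : Type*} [Fintype V] [DecidableEq V] (G : SimpleGraph V) : Set (V → ℝ) :=
  convexHull ℝ {x | ∃ I : Finset V, IsIndepSet G I ∧ x = charVec I}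

/-- `P` is a probability distribution on the (finite) vertex set `V`. -/
def IsProbDist {V : Type*} [Fintype V] (P : V → ℝ) : Prop :=
  (∀ v, 0 ≤ P v) ∧ ∑ v, P v = 1

/-- The entropy of the graph `G` with respect to `P`:
`H(G,P) = min_{a ∈ VP(G)} ∑_v p_v · log₂(1/a_v)`, where (by the convention
`0 · log₂(1/0) = 0`) coordinates with `p_v = 0` are irrelevant and the minimum
is never achieved with `a_v = 0` at a coordinate with `p_v > 0`; accordingly the
minimization is over points of `VP(G)` that are positive on the support of `P`. -/
noncomputable def graphEntropy {V : Type*} [Fintype V] [DecidableEq V]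
    (G : SimpleGraph V) (P : V → ℝ) : ℝ :=
  sInf { x | ∃ a ∈ vertexPacking G, (∀ v, 0 < P v → 0 < a v) ∧
      x = ∑ v, P v * Real.logb 2 (1 / a v) }

/-- The fractional chromatic number of `G`: the minimum of `∑_I w_I` over
nonnegative weight functions on the independent sets of `G` such that
`∑_{I ∋ v} w_I ≥ 1` for every vertex `v`. -/
noncomputable def fracChromatic {V : Type*} [Fintype V] [DecidableEq V]
    (G : SimpleGraph V) : ℝ :=
  sInf { x | ∃ w : Finset V → ℝ, (∀ I, 0 ≤ w I) ∧ (∀ I, w I ≠ 0 → IsIndepSet G I) ∧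
      (∀ v : V, 1 ≤ ∑ I ∈ Finset.univ.filter (fun I : Finset V => v ∈ I), w I) ∧
      x = ∑ I : Finset V, w I }

/-- The independence number `α(G)`. -/
noncomputable def indepNum {V : Type*} [Fintype V] (G : SimpleGraph V) : ℕ :=
  sSup {n | ∃ I : Finset V, IsIndepSet G I ∧ I.card = n}

/-- `I` is a maximum weighted independent set of `G` with respect to `P`. -/
def IsMaxWeightIndep {V : Type*} [Fintype V] (G : SimpleGraph V) (P : V → ℝ)
    (I : Finset V) : Prop :=
  IsIndepSet G I ∧ ∀ J : Finset V, IsIndepSet G J → ∑ v ∈ J, P v ≤ ∑ v ∈ I, P v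

/-- A multiset `S` of (independent) sets uniformly covers `W` if every vertex of `W`
belongs to exactly the same (positive) number of members of `S`, counted with
multiplicity. -/
def UniformOver {V : Type*} [DecidableEq V] (S : Multiset (Finset V)) (W : Set V) : Prop :=
  ∃ c : ℕ, 0 < c ∧ ∀ v ∈ W, (S.filter (fun I => v ∈ I)).card = c

/-- `G` is symmetric with respect to graph entropy: the uniform distribution
maximizes `H(G, ·)`. -/
def EntropySymmetric {V : Type*} [Fintype V] [DecidableEq V] (G : SimpleGraph V) : Prop :=
  ∀ P : V → ℝ, IsProbDist P →
    graphEntropy G P ≤ graphEntropy G (fun _ => (1 : ℝ) / Fintype.card V)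

theorem convex_vertexPacking {V : Type*} [Fintype V] [DecidableEq V] (G : SimpleGraph V) :
    Convex ℝ (vertexPacking G) :=
  convex_convexHull ℝ _

theorem charVec_mem_vertexPacking {V : Type*} [Fintype V] [DecidableEq V] {G : SimpleGraph V}
    {I : Finset V} (hI : IsIndepSet G I) : charVec I ∈ vertexPacking G :=
  subset_convexHull ℝ _ ⟨I, hI, rfl⟩

theorem le_one_of_mem_vertexPacking {V : Type*} [Fintype V] [DecidableEq V]
    {G : SimpleGraph V} {a : V → ℝ} (ha : a ∈ vertexPacking G) (v : V) : a v ≤ 1 := by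
  have hsub : vertexPacking G ⊆ Set.Iic (1 : V → ℝ) := by
    refine convexHull_min ?_ (convex_Iic 1)
    rintro x ⟨I, -, rfl⟩ v
    simp only [charVec, Pi.one_apply]
    split_ifs <;> norm_num
  exact hsub ha v

/-- Every feasible point of the packing polytope bounds the graph entropy from above. -/
theorem graphEntropy_le {V : Type*} [Fintype V] [DecidableEq V] {G : SimpleGraph V}
    {P : V → ℝ} (hP : IsProbDist P) {a : V → ℝ} (ha : a ∈ vertexPacking G)
    (hpos : ∀ v, 0 < P v → 0 < a v) :
    graphEntropy G P ≤ ∑ v, P v * Real.logb 2 (1 / a v) := by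
  refine csInf_le ⟨0, ?_⟩ ⟨a, ha, hpos, rfl⟩
  rintro x ⟨b, hb, hbpos, rfl⟩
  refine Finset.sum_nonneg fun v _ => ?_
  rcases (hP.1 v).eq_or_lt with h0 | h0
  · simp [← h0]
  · refine mul_nonneg h0.le (Real.logb_nonneg (by norm_num) ?_)
    rw [le_div_iff₀ (hbpos v h0)]
    linarith [le_one_of_mem_vertexPacking hb v]

/-- The normalization of a nonnegative weighting of independent sets lies in the packing
polytope. -/
theorem weighted_charVec_mem_vertexPacking {V : Type*} [Fintype V] [DecidableEq V]
    {G : SimpleGraph V} {w : Finset V → ℝ} {c : ℝ} (hc : 0 < c) (hw0 : ∀ I, 0 ≤ w I)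
    (hwI : ∀ I, w I ≠ 0 → IsIndepSet G I) (hws : ∑ I : Finset V, w I = c) :
    (fun v => ∑ I : Finset V, (w I / c) * charVec I v) ∈ vertexPacking G := by
  have hempty : IsIndepSet G ∅ := by simp [IsIndepSet]
  have key := (convex_vertexPacking G).sum_mem (t := Finset.univ) (w := fun I => w I / c)
    (z := fun I => if w I = 0 then charVec ∅ else charVec I)
    (fun I _ => div_nonneg (hw0 I) hc.le)
    (by rw [← Finset.sum_div, hws, div_self hc.ne'])
    (fun I _ => by
      split_ifs with h0
      · exact charVec_mem_vertexPacking hempty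
      · exact charVec_mem_vertexPacking (hwI I h0))
  convert key using 1
  ext v
  rw [Finset.sum_apply]
  refine Finset.sum_congr rfl fun I _ => ?_
  by_cases h0 : w I = 0 <;> simp [h0]

theorem sum_mul_charVec {V : Type*} [Fintype V] [DecidableEq V] (P : V → ℝ) (J : Finset V) :
    ∑ v, P v * charVec J v = ∑ v ∈ J, P v := by
  simp [charVec]

/-- If the entropy is attained at a point of the packing polytope that is constantly `1 / c` on
the support of `P`, then independent sets have `P`-weight at most `1 / c`. -/
theorem sum_mul_le_one_of_graphEntropy_eq_logb {V : Type*} [Fintype V] [DecidableEq V]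
    {G : SimpleGraph V} {P : V → ℝ} (hP : IsProbDist P) {c : ℝ} (hc : 1 ≤ c)
    (h : graphEntropy G P = Real.logb 2 c) {a : V → ℝ} (ha : a ∈ vertexPacking G)
    (hac : ∀ v, 0 < P v → a v = 1 / c) {J : Finset V} (hJ : IsIndepSet G J) :
    (∑ v ∈ J, P v) * c ≤ 1 := by
  have hc0 : 0 < c := by linarith
  set q := ∑ v ∈ J, P v with hq
  have hbound : ∀ t : ℝ, 0 < t → t < 1 → q * c - 1 ≤ t * (c - 1) := by
    intro t ht0 ht1
    have ht : 0 < 1 - t := by linarith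
    have hd : 0 < 1 + t * (c - 1) := by nlinarith
    have hmem := (convex_vertexPacking G) ha (charVec_mem_vertexPacking hJ) ht.le ht0.le
      (by ring)
    have hval : ∀ v, 0 < P v → ((1 - t) • a + t • charVec J) v
        = (if v ∈ J then 1 + t * (c - 1) else 1 - t) / c := by
      intro v hv
      simp only [Pi.add_apply, Pi.smul_apply, smul_eq_mul, hac v hv, charVec]
      split_ifs <;> field_simp <;> ring
    have hpos : ∀ v : V, 0 < (if v ∈ J then 1 + t * (c - 1) else 1 - t) := by
      intro v
      split_ifs <;> assumption
    have hle := graphEntropy_le hP hmem fun v hv => by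
      rw [hval v hv]
      exact div_pos (hpos v) hc0
    have hterm : ∀ v, P v * Real.logb 2 (1 / ((1 - t) • a + t • charVec J) v)
        ≤ P v * (Real.logb 2 c + (1 / (if v ∈ J then 1 + t * (c - 1) else 1 - t) - 1)
          / Real.log 2) := by
      intro v
      rcases (hP.1 v).eq_or_lt with h0 | h0
      · simp [← h0]
      · refine mul_le_mul_of_nonneg_left ?_ h0.le
        rw [hval v h0, one_div_div, div_eq_mul_one_div, Real.logb_mul hc0.ne'
          (one_div_pos.2 (hpos v)).ne']
        refine add_le_add_right ?_ _
        exact div_le_div_of_nonneg_right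
          (Real.log_le_sub_one_of_pos (one_div_pos.2 (hpos v))) (Real.log_nonneg (by norm_num))
    have hsum := hle.trans (Finset.sum_le_sum fun v _ => hterm v)
    have hsplit : ∀ v, P v * (Real.logb 2 c
          + (1 / (if v ∈ J then 1 + t * (c - 1) else 1 - t) - 1) / Real.log 2)
        = P v * (Real.logb 2 c + (1 / (1 - t) - 1) / Real.log 2)
          + P v * charVec J v * ((1 / (1 + t * (c - 1)) - 1 / (1 - t)) / Real.log 2) := by
      intro v
      simp only [charVec]
      split_ifs <;> ring
    simp only [hsplit] at hsum
    rw [Finset.sum_add_distrib, ← Finset.sum_mul, ← Finset.sum_mul, hP.2, sum_mul_charVec, ← hq,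
      h] at hsum
    have hlog : 0 < Real.log 2 := Real.log_pos (by norm_num)
    have hnn : 0 ≤ ((1 / (1 - t) - 1) + q * (1 / (1 + t * (c - 1)) - 1 / (1 - t)))
        / Real.log 2 := by
      have : ((1 / (1 - t) - 1) + q * (1 / (1 + t * (c - 1)) - 1 / (1 - t))) / Real.log 2
        = (1 / (1 - t) - 1) / Real.log 2
          + q * ((1 / (1 + t * (c - 1)) - 1 / (1 - t)) / Real.log 2) := by ring
      linarith
    have hnum := (le_div_iff₀ hlog).1 hnn
    rw [zero_mul] at hnum
    have heq : (1 / (1 - t) - 1) + q * (1 / (1 + t * (c - 1)) - 1 / (1 - t))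
        = t * (t * (c - 1) - (q * c - 1)) / ((1 - t) * (1 + t * (c - 1))) := by
      field_simp
      ring
    rw [heq, le_div_iff₀ (mul_pos ht hd), zero_mul] at hnum
    linarith [(mul_nonneg_iff_of_pos_left ht0).1 hnum]
  by_contra! hlt
  have hden : 0 < c + (q * c - 1) := by linarith
  have hb := hbound ((q * c - 1) / (c + (q * c - 1))) (div_pos (by linarith) hden)
    (by rw [div_lt_one hden]; linarith)
  rw [div_mul_eq_mul_div, le_div_iff₀ hden] at hb
  nlinarith

/-- If `H(G,P) = log₂ χ_f(G)` and `w` is an optimal fractional coloring, then the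
point `x* = ∑_I (w_I/χ_f(G))·1_I` of `VP(G)` satisfies `x*_v = 1/χ_f(G)` on the
support of `P`, and every independent set with positive weight is a maximum
weighted independent set with respect to `P` (of weight `α_P`). -/
theorem optimal_fractional_coloring_of_entropy_eq_logb_fracChromatic
    {V : Type*} [Fintype V] [DecidableEq V] (G : SimpleGraph V)
    (P : V → ℝ) (hP : IsProbDist P)
    (h : graphEntropy G P = Real.logb 2 (fracChromatic G))
    (w : Finset V → ℝ) (hw0 : ∀ I, 0 ≤ w I) (hwI : ∀ I, w I ≠ 0 → IsIndepSet G I)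
    (hwc : ∀ v : V, 1 ≤ ∑ I ∈ Finset.univ.filter (fun I : Finset V => v ∈ I), w I)
    (hws : ∑ I : Finset V, w I = fracChromatic G) :
    (∀ v : V, 0 < P v →
        (∑ I : Finset V, (w I / fracChromatic G) * charVec I v) = 1 / fracChromatic G) ∧
      ∀ I : Finset V, w I ≠ 0 →
        ∑ v ∈ I, P v =
          sSup {x : ℝ | ∃ J : Finset V, IsIndepSet G J ∧ x = ∑ v ∈ J, P v} := by
  set c := fracChromatic G with hcdef
  set a : V → ℝ := fun v => ∑ I : Finset V, (w I / c) * charVec I v with hadef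
  have hne : Nonempty V := by
    by_contra hV
    rw [not_nonempty_iff] at hV
    simpa using hP.2
  have hc : 1 ≤ c := by
    obtain ⟨v⟩ := hne
    rw [← hws]
    exact (hwc v).trans
      (Finset.sum_le_sum_of_subset_of_nonneg (Finset.filter_subset _ _) fun I _ _ => hw0 I)
  have hc0 : 0 < c := by linarith
  have ha : a ∈ vertexPacking G := weighted_charVec_mem_vertexPacking hc0 hw0 hwI hws
  have hage : ∀ v, 1 / c ≤ a v := by
    intro v
    have : a v = (∑ I ∈ Finset.univ.filter (fun I : Finset V => v ∈ I), w I) / c := by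
      simp only [hadef, charVec, mul_ite, mul_one, mul_zero]
      rw [← Finset.sum_filter, Finset.sum_div]
    rw [this]
    exact div_le_div_of_nonneg_right (hwc v) hc0.le
  have hapos : ∀ v, 0 < a v := fun v => (one_div_pos.2 hc0).trans_le (hage v)
  have hlogle : ∀ v, Real.logb 2 (1 / a v) ≤ Real.logb 2 c := fun v =>
    Real.logb_le_logb_of_le (by norm_num) (one_div_pos.2 (hapos v))
      ((one_div_le (hapos v) hc0).2 (hage v))
  have hac : ∀ v, 0 < P v → a v = 1 / c := by
    have hsum : ∑ v, P v * Real.logb 2 (1 / a v) = ∑ v, P v * Real.logb 2 c := by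
      refine le_antisymm
        (Finset.sum_le_sum fun v _ => mul_le_mul_of_nonneg_left (hlogle v) (hP.1 v)) ?_
      rw [← Finset.sum_mul, hP.2, one_mul, ← h]
      exact graphEntropy_le hP ha fun v _ => hapos v
    intro v hv
    have hterm := (Finset.sum_eq_sum_iff_of_le fun v _ =>
      mul_le_mul_of_nonneg_left (hlogle v) (hP.1 v)).1 hsum v (Finset.mem_univ v)
    have hinj := Real.logb_injOn_pos (by norm_num : (1 : ℝ) < 2) (one_div_pos.2 (hapos v)) hc0
      (mul_left_cancel₀ hv.ne' hterm)
    rw [← hinj, one_div_one_div]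
  refine ⟨hac, ?_⟩
  have hmax : ∀ J, IsIndepSet G J → (∑ v ∈ J, P v) * c ≤ 1 := fun J hJ =>
    sum_mul_le_one_of_graphEntropy_eq_logb hP hc h ha hac hJ
  have htotal : ∑ I : Finset V, w I * ((∑ v ∈ I, P v) * c) = ∑ I : Finset V, w I := by
    have hPa : ∑ v, P v * a v = 1 / c := by
      have hconst : ∑ v, P v * (1 / c) = 1 / c := by rw [← Finset.sum_mul, hP.2, one_mul]
      refine Eq.trans ?_ hconst
      refine Finset.sum_congr rfl fun v _ => ?_
      rcases (hP.1 v).eq_or_lt with h0 | h0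
      · simp [← h0]
      · rw [hac v h0]
    have hswap : ∑ v, P v * a v = ∑ I : Finset V, (w I / c) * ∑ v ∈ I, P v := by
      simp only [hadef, Finset.mul_sum, ← sum_mul_charVec P]
      rw [Finset.sum_comm]
      exact Finset.sum_congr rfl fun I _ => Finset.sum_congr rfl fun v _ => by ring
    have hscale : ∑ I : Finset V, w I * ((∑ v ∈ I, P v) * c)
        = (∑ I : Finset V, (w I / c) * ∑ v ∈ I, P v) * (c * c) := by
      rw [Finset.sum_mul]
      exact Finset.sum_congr rfl fun I _ => by field_simp
    rw [hscale, ← hswap, hPa, hws]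
    field_simp
  have hwle : ∀ I ∈ Finset.univ, w I * ((∑ v ∈ I, P v) * c) ≤ w I := by
    intro I _
    by_cases h0 : w I = 0
    · simp [h0]
    · exact mul_le_of_le_one_right (hw0 I) (hmax I (hwI I h0))
  intro I hI
  have hIeq : (∑ v ∈ I, P v) * c = 1 :=
    mul_left_cancel₀ hI
      (((Finset.sum_eq_sum_iff_of_le hwle).1 htotal I (Finset.mem_univ I)).trans (mul_one _).symm)
  have hgreatest : IsGreatest {x : ℝ | ∃ J : Finset V, IsIndepSet G J ∧ x = ∑ v ∈ J, P v}
      (∑ v ∈ I, P v) := by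
    refine ⟨⟨I, hwI I hI, rfl⟩, ?_⟩
    rintro x ⟨J, hJ, rfl⟩
    exact le_of_mul_le_mul_right ((hmax J hJ).trans hIeq.ge) hc0
  exact hgreatest.csSup_eq.symm
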